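/- Fix q ∈ (1,∞] and let p satisfy 1/p + 1/q = 1. Take the square loss l(x,y;β) = (y − βᵀx)^2 and the cost c((x,y),(u,v)) = (N_q((x,y),(u,v)))^2, where N_q((x,y),(u,v)) = ‖x − u‖_q if y = v and +∞ otherwise. Then for every δ > 0, min_{β ∈ ℝ^d} sup { E_P[l(X,Y;β)] : D_c(P,P_n) ≤ δ } = min_{β ∈ ℝ^d} ( √(MSE_n(β)) + √δ · ‖β‖_p )^2, where MSE_n(β) = (1/n) Σ_{i=1}^n (Y_i − βᵀX_i)^2. -/

import Mathlib

open MeasureTheory ProbabilityTheory Filter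
open scoped ENNReal NNReal Topology

noncomputable section

/-- The ℓ_p norm on `Fin d → ℝ`, for `p ∈ [1,∞]`. -/
def lpNorm (p : ℝ≥0∞) {d : ℕ} (x : Fin d → ℝ) : ℝ :=
  if p = ⊤ then ⨆ i, |x i| else (∑ i, |x i| ^ p.toReal) ^ (1 / p.toReal)

/-- Optimal transport discrepancy with cost `c`. -/
def OTCost {α : Type*} [MeasurableSpace α] (c : α → α → ℝ≥0∞) (P Q : Measure α) : ℝ≥0∞ :=
  ⨅ (π : Measure (α × α)) (_ : IsProbabilityMeasure π) (_ : π.map Prod.fst = P)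
    (_ : π.map Prod.snd = Q), ∫⁻ z, c z.1 z.2 ∂π

/-- Empirical measure of the points `W 0, …, W (n-1)`. -/
def empMeas {α : Type*} [MeasurableSpace α] {n : ℕ} (W : Fin n → α) : Measure α :=
  (n : ℝ≥0∞)⁻¹ • ∑ i, Measure.dirac (W i)

/-- Extended-real-valued expectation `E_P[l]`, defined via positive and negative parts. -/
def eExp {α : Type*} [MeasurableSpace α] (P : Measure α) (l : α → ℝ) : EReal :=
  ((∫⁻ z, ENNReal.ofReal (l z) ∂P : ℝ≥0∞) : EReal)
    - ((∫⁻ z, ENNReal.ofReal (-(l z)) ∂P : ℝ≥0∞) : EReal)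

theorem ne_top_of_inv_add_inv_eq_one {p q : ℝ≥0∞} (hq : 1 < q) (hpq : p⁻¹ + q⁻¹ = 1) :
    p ≠ ⊤ := by
  rintro rfl
  simp only [ENNReal.inv_top, zero_add, ENNReal.inv_eq_one] at hpq
  exact hq.ne' hpq

theorem holderConjugate_toReal {p q : ℝ≥0∞} (hq : 1 < q) (hqt : q ≠ ⊤)
    (hpq : p⁻¹ + q⁻¹ = 1) : p.toReal.HolderConjugate q.toReal := by
  have h_symm : q.toReal.HolderConjugate p.toReal := by
    rw [Real.holderConjugate_iff]
    refine ⟨by simpa using (ENNReal.toReal_lt_toReal ENNReal.one_ne_top hqt).2 hq, ?_⟩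
    have hp0 : p⁻¹ ≠ ⊤ := fun h => by simp [h] at hpq
    have hq0 : q⁻¹ ≠ ⊤ := fun h => by simp [h] at hpq
    rw [← ENNReal.toReal_inv, ← ENNReal.toReal_inv, add_comm, ← ENNReal.toReal_add hp0 hq0, hpq,
      ENNReal.toReal_one]
  exact h_symm.symm

/-- **Hölder's inequality** for the `ℓ_p` and `ℓ_q` norms on `Fin d → ℝ`. -/
theorem abs_sum_mul_le_lpNorm_mul_lpNorm {d : ℕ} {p q : ℝ≥0∞} (hq : 1 < q)
    (hpq : p⁻¹ + q⁻¹ = 1) (b z : Fin d → ℝ) :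
    |∑ j, b j * z j| ≤ _root_.lpNorm p b * _root_.lpNorm q z := by
  by_cases hqt : q = ⊤
  · obtain rfl : p = 1 := by simpa [hqt] using hpq
    have h_le : ∀ j, |z j| ≤ ⨆ i, |z i| := le_ciSup (Set.finite_range _).bddAbove
    simp only [_root_.lpNorm, hqt, ENNReal.one_ne_top, if_true, if_false, ENNReal.toReal_one,
      Real.rpow_one, div_one]
    calc |∑ j, b j * z j| ≤ ∑ j, |b j * z j| := Finset.abs_sum_le_sum_abs _ _
      _ ≤ ∑ j, |b j| * ⨆ i, |z i| := Finset.sum_le_sum fun j _ => by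
          rw [abs_mul]; exact mul_le_mul_of_nonneg_left (h_le j) (abs_nonneg _)
      _ = _ := (Finset.sum_mul _ _ _).symm
  · have hH := holderConjugate_toReal hq hqt hpq
    have hpt := ne_top_of_inv_add_inv_eq_one hq hpq
    simp only [_root_.lpNorm, hqt, hpt, if_false]
    calc |∑ j, b j * z j| ≤ ∑ j, |b j * z j| := Finset.abs_sum_le_sum_abs _ _
      _ = ∑ j, |b j| * |z j| := by simp only [abs_mul]
      _ ≤ _ := by
          simpa only [abs_abs] using
            Real.inner_le_Lp_mul_Lq Finset.univ (fun j => |b j|) (fun j => |z j|) hH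

/-- The `ℓ_p` norm is attained by duality against the `ℓ_q` unit ball. -/
theorem exists_lpNorm_le_one_sum_mul_eq_lpNorm {d : ℕ} {p q : ℝ≥0∞} (hq : 1 < q)
    (hpq : p⁻¹ + q⁻¹ = 1) (b : Fin d → ℝ) :
    ∃ w : Fin d → ℝ, _root_.lpNorm q w ≤ 1 ∧ ∑ j, b j * w j = _root_.lpNorm p b := by
  have h_sign : ∀ x : ℝ, |(SignType.sign x : ℝ)| ≤ 1 := fun x => by
    rcases lt_trichotomy x 0 with h | h | h <;> simp [h]
  by_cases hqt : q = ⊤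
  · obtain rfl : p = 1 := by simpa [hqt] using hpq
    refine ⟨fun j => SignType.sign (b j), ?_, ?_⟩
    · simp only [_root_.lpNorm, hqt, if_true]
      exact Real.iSup_le (fun j => h_sign _) zero_le_one
    · simp [_root_.lpNorm, mul_comm (b _)]
  · have hH := holderConjugate_toReal hq hqt hpq
    have hpt := ne_top_of_inv_add_inv_eq_one hq hpq
    obtain ⟨g, hg, hbg⟩ :=
      (NNReal.isGreatest_Lp Finset.univ (fun j => Real.nnabs (b j)) hH).1
    refine ⟨fun j => SignType.sign (b j) * g j, ?_, ?_⟩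
    · simp only [_root_.lpNorm, hqt, if_false]
      refine Real.rpow_le_one (Finset.sum_nonneg fun j _ => by positivity) ?_ (by positivity)
      calc ∑ j, |(SignType.sign (b j) : ℝ) * g j| ^ q.toReal
          ≤ ∑ j, (g j : ℝ) ^ q.toReal := Finset.sum_le_sum fun j _ => by
            refine Real.rpow_le_rpow (abs_nonneg _) ?_ ENNReal.toReal_nonneg
            rw [abs_mul, NNReal.abs_eq]
            exact mul_le_of_le_one_left (g j).2 (h_sign _)
        _ ≤ 1 := by exact_mod_cast hg
    · have h := congrArg ((↑) : ℝ≥0 → ℝ) hbg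
      simp only [NNReal.coe_sum, NNReal.coe_mul, NNReal.coe_rpow, Real.coe_nnabs] at h
      simp only [_root_.lpNorm, hpt, if_false, ← h, ← mul_assoc, self_mul_sign]

theorem lpNorm_nonneg {d : ℕ} (p : ℝ≥0∞) (x : Fin d → ℝ) : 0 ≤ _root_.lpNorm p x := by
  unfold _root_.lpNorm
  split_ifs
  · exact Real.iSup_nonneg fun j => abs_nonneg _
  · positivity

theorem lpNorm_smul_le {d : ℕ} {q : ℝ≥0∞} (hq : 1 < q) (a : ℝ) (x : Fin d → ℝ) :
    _root_.lpNorm q (a • x) ≤ |a| * _root_.lpNorm q x := by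
  unfold _root_.lpNorm
  split_ifs with hqt
  · exact (Real.mul_iSup_of_nonneg (abs_nonneg a) _ ▸ by simp [abs_mul])
  · have hq0 : q.toReal ≠ 0 := (ENNReal.toReal_pos (zero_lt_one.trans hq).ne' hqt).ne'
    simp only [Pi.smul_apply, smul_eq_mul, abs_mul, Real.mul_rpow (abs_nonneg _) (abs_nonneg _),
      ← Finset.mul_sum]
    rw [Real.mul_rpow (by positivity) (by positivity), ← Real.rpow_mul (abs_nonneg a),
      mul_one_div_cancel hq0, Real.rpow_one]

section EmpiricalMeasure

variable {α γ : Type*} [MeasurableSpace α] [MeasurableSpace γ] {n : ℕ}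

theorem isProbabilityMeasure_empMeas (hn : 0 < n) (W : Fin n → α) :
    IsProbabilityMeasure (empMeas W) := by
  constructor
  simp [empMeas, ENNReal.inv_mul_cancel (Nat.cast_ne_zero.2 hn.ne') (ENNReal.natCast_ne_top n)]

theorem map_empMeas (W : Fin n → α) {f : α → γ} (hf : Measurable f) :
    (empMeas W).map f = empMeas (fun i => f (W i)) := by
  simp only [empMeas, Measure.map_smul, Measure.map_finset_sum hf.aemeasurable,
    Measure.map_dirac' hf]

theorem lintegral_empMeas [MeasurableSingletonClass α] (W : Fin n → α) (f : α → ℝ≥0∞) :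
    ∫⁻ z, f z ∂(empMeas W) = (n : ℝ≥0∞)⁻¹ * ∑ i, f (W i) := by
  simp [empMeas, lintegral_smul_measure]

theorem lintegral_empMeas_ofReal [MeasurableSingletonClass α] (hn : 0 < n) (W : Fin n → α)
    {f : α → ℝ} (hf : ∀ z, 0 ≤ f z) :
    ∫⁻ z, ENNReal.ofReal (f z) ∂(empMeas W)
      = ENNReal.ofReal ((n : ℝ)⁻¹ * ∑ i, f (W i)) := by
  rw [lintegral_empMeas, ENNReal.ofReal_mul (by positivity),
    ENNReal.ofReal_sum_of_nonneg fun i _ => hf _,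
    ENNReal.ofReal_inv_of_pos (by exact_mod_cast hn), ENNReal.ofReal_natCast]

end EmpiricalMeasure

theorem eExp_of_nonneg {α : Type*} [MeasurableSpace α] (P : Measure α) {l : α → ℝ}
    (hl : ∀ z, 0 ≤ l z) : eExp P l = ((∫⁻ z, ENNReal.ofReal (l z) ∂P : ℝ≥0∞) : EReal) := by
  simp [eExp, ENNReal.ofReal_of_nonpos (neg_nonpos.2 (hl _))]

theorem measurable_residual {d : ℕ} (b : Fin d → ℝ) :
    Measurable fun z : (Fin d → ℝ) × ℝ => z.2 - ∑ j, b j * z.1 j := by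
  fun_prop

section Transport

variable {d : ℕ} {q p : ℝ≥0∞} {c : ((Fin d → ℝ) × ℝ) → ((Fin d → ℝ) × ℝ) → ℝ≥0∞}

theorem ae_snd_eq_of_lintegral_cost_ne_top
    (hc : ∀ x y u v, c (x, y) (u, v) =
      if y = v then ENNReal.ofReal (_root_.lpNorm q (x - u) ^ 2) else ⊤)
    {π : Measure (((Fin d → ℝ) × ℝ) × ((Fin d → ℝ) × ℝ))}
    (hπ : ∫⁻ z, c z.1 z.2 ∂π ≠ ⊤) : ∀ᵐ z ∂π, z.1.2 = z.2.2 := by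
  have h_meas : MeasurableSet {z : ((Fin d → ℝ) × ℝ) × ((Fin d → ℝ) × ℝ) | z.1.2 ≠ z.2.2} :=
    (measurableSet_eq_fun (by fun_prop) (by fun_prop)).compl
  rw [ae_iff]
  by_contra h_ne
  refine hπ (top_unique ?_)
  calc (⊤ : ℝ≥0∞) = ⊤ * π {z | z.1.2 ≠ z.2.2} := (ENNReal.top_mul h_ne).symm
    _ = ∫⁻ z, {z | z.1.2 ≠ z.2.2}.indicator (fun _ => ⊤) z ∂π :=
        (lintegral_indicator_const h_meas _).symm
    _ ≤ ∫⁻ z, c z.1 z.2 ∂π := lintegral_mono fun z => by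
        obtain ⟨⟨x, y⟩, u, v⟩ := z
        by_cases h : y = v <;> simp [h, hc]

/-- Minkowski's inequality for the residual along a coupling. -/
theorem lintegral_residual_sq_le (hq : 1 < q) (hpq : p⁻¹ + q⁻¹ = 1)
    (hc : ∀ x y u v, c (x, y) (u, v) =
      if y = v then ENNReal.ofReal (_root_.lpNorm q (x - u) ^ 2) else ⊤)
    {π : Measure (((Fin d → ℝ) × ℝ) × ((Fin d → ℝ) × ℝ))}
    (b : Fin d → ℝ) {m t : ℝ} (hm : 0 ≤ m) (ht : 0 ≤ t)
    (h_fit : ∫⁻ z, ENNReal.ofReal ((z.2.2 - ∑ j, b j * z.2.1 j) ^ 2) ∂π ≤ ENNReal.ofReal m)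
    (h_cost : ∫⁻ z, c z.1 z.2 ∂π ≤ ENNReal.ofReal t) :
    ∫⁻ z, ENNReal.ofReal ((z.1.2 - ∑ j, b j * z.1.1 j) ^ 2) ∂π
      ≤ ENNReal.ofReal ((√m + √t * _root_.lpNorm p b) ^ 2) := by
  have h_ae := ae_snd_eq_of_lintegral_cost_ne_top hc (h_cost.trans_lt ENNReal.ofReal_lt_top).ne
  have hb := lpNorm_nonneg p b
  have h_sq : ∀ a : ℝ, ENNReal.ofReal |a| ^ (2 : ℝ) = ENNReal.ofReal (a ^ 2) := fun a => by
    rw [ENNReal.ofReal_rpow_of_nonneg (abs_nonneg a) zero_le_two, Real.rpow_two, sq_abs]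
  have h_sqrt : ∀ a : ℝ, 0 ≤ a → ENNReal.ofReal a ^ (1 / 2 : ℝ) = ENNReal.ofReal √a :=
    fun a ha => by rw [ENNReal.ofReal_rpow_of_nonneg ha (by norm_num), Real.sqrt_eq_rpow]
  set f : ((Fin d → ℝ) × ℝ) × ((Fin d → ℝ) × ℝ) → ℝ≥0∞ :=
    fun z => ENNReal.ofReal |z.2.2 - ∑ j, b j * z.2.1 j| with hf
  set g : ((Fin d → ℝ) × ℝ) × ((Fin d → ℝ) × ℝ) → ℝ≥0∞ :=
    fun z => ENNReal.ofReal |∑ j, b j * (z.1.1 j - z.2.1 j)| with hg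
  have hfm : Measurable f := by fun_prop
  have hgm : Measurable g := by fun_prop
  have h_transport : ∫⁻ z, g z ^ (2 : ℝ) ∂π ≤ ENNReal.ofReal (t * _root_.lpNorm p b ^ 2) := by
    calc ∫⁻ z, g z ^ (2 : ℝ) ∂π
        ≤ ∫⁻ z, ENNReal.ofReal (_root_.lpNorm p b ^ 2) * c z.1 z.2 ∂π := by
          refine lintegral_mono_ae (h_ae.mono ?_)
          rintro ⟨⟨x, y⟩, u, v⟩ hz
          rw [hc, if_pos hz, ← ENNReal.ofReal_mul (sq_nonneg _), h_sq, ← mul_pow]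
          refine ENNReal.ofReal_le_ofReal (sq_le_sq' ?_ ?_)
          · exact (abs_le.1 (abs_sum_mul_le_lpNorm_mul_lpNorm hq hpq b (x - u))).1
          · exact (abs_le.1 (abs_sum_mul_le_lpNorm_mul_lpNorm hq hpq b (x - u))).2
      _ = ENNReal.ofReal (_root_.lpNorm p b ^ 2) * ∫⁻ z, c z.1 z.2 ∂π :=
          lintegral_const_mul' _ _ ENNReal.ofReal_ne_top
      _ ≤ ENNReal.ofReal (_root_.lpNorm p b ^ 2) * ENNReal.ofReal t := by gcongr
      _ = _ := by rw [← ENNReal.ofReal_mul (sq_nonneg _), mul_comm]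
  have h_norm : (∫⁻ z, (f + g) z ^ (2 : ℝ) ∂π) ^ (1 / 2 : ℝ)
      ≤ ENNReal.ofReal (√m + √t * _root_.lpNorm p b) := by
    calc _ ≤ (∫⁻ z, f z ^ (2 : ℝ) ∂π) ^ (1 / 2 : ℝ) + (∫⁻ z, g z ^ (2 : ℝ) ∂π) ^ (1 / 2 : ℝ) :=
          ENNReal.lintegral_Lp_add_le hfm.aemeasurable hgm.aemeasurable one_le_two
      _ ≤ ENNReal.ofReal m ^ (1 / 2 : ℝ)
            + ENNReal.ofReal (t * _root_.lpNorm p b ^ 2) ^ (1 / 2 : ℝ) := by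
          simp only [hf, h_sq] at h_fit ⊢
          gcongr
      _ = _ := by
          rw [h_sqrt m hm, h_sqrt _ (by positivity), Real.sqrt_mul ht, Real.sqrt_sq hb,
            ← ENNReal.ofReal_add (by positivity) (by positivity)]
  calc ∫⁻ z, ENNReal.ofReal ((z.1.2 - ∑ j, b j * z.1.1 j) ^ 2) ∂π
      ≤ ∫⁻ z, (f + g) z ^ (2 : ℝ) ∂π := by
        refine lintegral_mono_ae (h_ae.mono ?_)
        rintro ⟨⟨x, y⟩, u, v⟩ (rfl : y = v)
        rw [← h_sq]
        refine ENNReal.rpow_le_rpow ?_ zero_le_two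
        rw [Pi.add_apply, ← ENNReal.ofReal_add (abs_nonneg _) (abs_nonneg _)]
        refine ENNReal.ofReal_le_ofReal ?_
        have h_split : y - ∑ j, b j * x j
            = (y - ∑ j, b j * u j) - ∑ j, b j * (x j - u j) := by
          simp only [mul_sub, Finset.sum_sub_distrib]; ring
        dsimp only
        rw [h_split]
        exact abs_sub _ _
    _ = ((∫⁻ z, (f + g) z ^ (2 : ℝ) ∂π) ^ (1 / 2 : ℝ)) ^ (2 : ℝ) := by
        rw [← ENNReal.rpow_mul]; norm_num
    _ ≤ ENNReal.ofReal (√m + √t * _root_.lpNorm p b) ^ (2 : ℝ) :=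
        ENNReal.rpow_le_rpow h_norm zero_le_two
    _ = _ := by
        rw [ENNReal.ofReal_rpow_of_nonneg (by positivity) zero_le_two, Real.rpow_two]

variable {n : ℕ} (X : Fin n → (Fin d → ℝ)) (Y : Fin n → ℝ)

theorem lintegral_residual_sq_le_of_OTCost_le (hn : 0 < n) (hq : 1 < q) (hpq : p⁻¹ + q⁻¹ = 1)
    (hc : ∀ x y u v, c (x, y) (u, v) =
      if y = v then ENNReal.ofReal (_root_.lpNorm q (x - u) ^ 2) else ⊤)
    {δ : ℝ} (hδ : 0 ≤ δ) (b : Fin d → ℝ) {P : Measure ((Fin d → ℝ) × ℝ)}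
    (hP : OTCost c P (empMeas (fun i => (X i, Y i))) ≤ ENNReal.ofReal δ) :
    ∫⁻ z, ENNReal.ofReal ((z.2 - ∑ j, b j * z.1 j) ^ 2) ∂P
      ≤ ENNReal.ofReal ((√((n : ℝ)⁻¹ * ∑ i, (Y i - ∑ j, b j * X i j) ^ 2)
          + √δ * _root_.lpNorm p b) ^ 2) := by
  have h_meas : Measurable fun z : (Fin d → ℝ) × ℝ =>
      ENNReal.ofReal ((z.2 - ∑ j, b j * z.1 j) ^ 2) :=
    ((measurable_residual b).pow_const 2).ennreal_ofReal
  set m := (n : ℝ)⁻¹ * ∑ i, (Y i - ∑ j, b j * X i j) ^ 2 with hm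
  have h_slack : ∀ t, δ < t → ∫⁻ z, ENNReal.ofReal ((z.2 - ∑ j, b j * z.1 j) ^ 2) ∂P
      ≤ ENNReal.ofReal ((√m + √t * _root_.lpNorm p b) ^ 2) := by
    intro t ht
    have h_lt := hP.trans_lt ((ENNReal.ofReal_lt_ofReal_iff (hδ.trans_lt ht)).2 ht)
    simp only [OTCost, iInf_lt_iff] at h_lt
    obtain ⟨π, -, hfst, hsnd, hπ⟩ := h_lt
    rw [← hfst, lintegral_map h_meas measurable_fst]
    refine lintegral_residual_sq_le hq hpq hc b (by positivity) (hδ.trans ht.le) ?_ hπ.le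
    rw [← lintegral_map h_meas measurable_snd, hsnd,
      lintegral_empMeas_ofReal hn _ fun z => sq_nonneg _]
  have h_cont : Continuous fun t : ℝ =>
      ENNReal.ofReal ((√m + √t * _root_.lpNorm p b) ^ 2) :=
    ENNReal.continuous_ofReal.comp (by fun_prop)
  exact ge_of_tendsto (h_cont.continuousWithinAt (s := Set.Ioi δ) (x := δ))
    (eventually_nhdsWithin_of_forall h_slack)

/-- The worst-case distribution moves every covariate along a dual direction of `b`, in
proportion to its residual. -/
theorem exists_OTCost_le_lintegral_residual_sq_eq (hn : 0 < n) (hq : 1 < q)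
    (hpq : p⁻¹ + q⁻¹ = 1)
    (hc : ∀ x y u v, c (x, y) (u, v) =
      if y = v then ENNReal.ofReal (_root_.lpNorm q (x - u) ^ 2) else ⊤)
    {δ : ℝ} (hδ : 0 ≤ δ) (b : Fin d → ℝ) :
    ∃ P : Measure ((Fin d → ℝ) × ℝ), IsProbabilityMeasure P ∧
      OTCost c P (empMeas (fun i => (X i, Y i))) ≤ ENNReal.ofReal δ ∧
      ∫⁻ z, ENNReal.ofReal ((z.2 - ∑ j, b j * z.1 j) ^ 2) ∂P
        = ENNReal.ofReal ((√((n : ℝ)⁻¹ * ∑ i, (Y i - ∑ j, b j * X i j) ^ 2)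
          + √δ * _root_.lpNorm p b) ^ 2) := by
  obtain ⟨w, hw, hbw⟩ := exists_lpNorm_le_one_sum_mul_eq_lpNorm hq hpq b
  have hn' : (n : ℝ) ≠ 0 := by exact_mod_cast hn.ne'
  set r : Fin n → ℝ := fun i => Y i - ∑ j, b j * X i j with hr
  change ∃ P : Measure ((Fin d → ℝ) × ℝ), IsProbabilityMeasure P ∧
    OTCost c P (empMeas (fun i => (X i, Y i))) ≤ ENNReal.ofReal δ ∧
    ∫⁻ z, ENNReal.ofReal ((z.2 - ∑ j, b j * z.1 j) ^ 2) ∂P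
      = ENNReal.ofReal ((√((n : ℝ)⁻¹ * ∑ i, r i ^ 2) + √δ * _root_.lpNorm p b) ^ 2)
  set m := (n : ℝ)⁻¹ * ∑ i, r i ^ 2 with hm
  have hm0 : 0 ≤ m := by positivity
  obtain ⟨s, hs, hrs⟩ : ∃ s : Fin n → ℝ, (n : ℝ)⁻¹ * ∑ i, s i ^ 2 = 1 ∧
      ∀ i, r i = √m * s i := by
    rcases hm0.eq_or_lt with h | h
    · refine ⟨fun _ => 1, by simp [hn'], fun i => ?_⟩
      have h_sum : ∑ i, r i ^ 2 = 0 :=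
        (mul_eq_zero.1 (hm.symm.trans h.symm)).resolve_left (inv_ne_zero hn')
      have := (Finset.sum_eq_zero_iff_of_nonneg fun i _ => sq_nonneg (r i)).1 h_sum i
        (Finset.mem_univ i)
      simpa [← h] using this
    · have h_sqrt : √m ≠ 0 := (Real.sqrt_pos.2 h).ne'
      refine ⟨fun i => r i / √m, ?_, fun i => (mul_div_cancel₀ _ h_sqrt).symm⟩
      simp only [div_pow, Real.sq_sqrt hm0, ← Finset.sum_div]
      rw [← mul_div_assoc, ← hm, div_self h.ne']
  set X' : Fin n → (Fin d → ℝ) := fun i => X i - (√δ * s i) • w with hX'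
  have h_res : ∀ i, Y i - ∑ j, b j * X' i j = s i * (√m + √δ * _root_.lpNorm p b) := by
    intro i
    have h_sum : ∑ j, b j * X' i j = ∑ j, b j * X i j - √δ * s i * _root_.lpNorm p b := by
      simp only [hX', Pi.sub_apply, Pi.smul_apply, smul_eq_mul, mul_sub, Finset.sum_sub_distrib,
        ← hbw, Finset.mul_sum]
      congr 1
      exact Finset.sum_congr rfl fun j _ => by ring
    rw [h_sum]
    linear_combination hrs i
  have h_shift : ∀ i, _root_.lpNorm q (X' i - X i) ^ 2 ≤ δ * s i ^ 2 := by
    intro i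
    have h_eq : X' i - X i = (-(√δ * s i)) • w := by simp [hX']
    have h_le : _root_.lpNorm q (X' i - X i) ≤ |√δ * s i| := by
      rw [h_eq]
      refine (lpNorm_smul_le hq _ _).trans ?_
      rw [abs_neg]
      exact mul_le_of_le_one_right (abs_nonneg _) hw
    calc _ ≤ |√δ * s i| ^ 2 := pow_le_pow_left₀ (lpNorm_nonneg _ _) h_le 2
      _ = δ * s i ^ 2 := by rw [sq_abs, mul_pow, Real.sq_sqrt hδ]
  refine ⟨empMeas (fun i => (X' i, Y i)), isProbabilityMeasure_empMeas hn _, ?_, ?_⟩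
  · refine (iInf₂_le_of_le (empMeas (fun i => ((X' i, Y i), (X i, Y i))))
      (isProbabilityMeasure_empMeas hn _) (iInf₂_le_of_le (map_empMeas _ measurable_fst)
        (map_empMeas _ measurable_snd) ?_))
    rw [lintegral_empMeas]
    simp only [hc, if_true]
    rw [← ENNReal.ofReal_sum_of_nonneg fun i _ => sq_nonneg _, ← ENNReal.ofReal_natCast,
      ← ENNReal.ofReal_inv_of_pos (by exact_mod_cast hn), ← ENNReal.ofReal_mul (by positivity)]
    refine ENNReal.ofReal_le_ofReal ?_
    calc (n : ℝ)⁻¹ * ∑ i, _root_.lpNorm q (X' i - X i) ^ 2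
        ≤ (n : ℝ)⁻¹ * ∑ i, δ * s i ^ 2 := by gcongr with i; exact h_shift i
      _ = δ * ((n : ℝ)⁻¹ * ∑ i, s i ^ 2) := by rw [← Finset.mul_sum]; ring
      _ = δ := by rw [hs, mul_one]
  · rw [lintegral_empMeas_ofReal hn _ fun z => sq_nonneg _]
    simp only [h_res, mul_pow, ← Finset.sum_mul]
    rw [← mul_assoc, hs, one_mul]

end Transport

theorem EReal.coe_iInf_of_nonneg {ι : Type*} [Nonempty ι] {f : ι → ℝ} (hf : ∀ i, 0 ≤ f i) :
    ((⨅ i, f i : ℝ) : EReal) = ⨅ i, (f i : EReal) := by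
  have h_bdd : BddBelow (Set.range f) := ⟨0, Set.forall_mem_range.2 hf⟩
  exact Monotone.map_ciInf_of_continuousAt continuous_coe_real_ereal.continuousAt
    EReal.coe_strictMono.monotone h_bdd

/-- exact recovery of ℓ_p-penalized (generalized LASSO) regression: with the
square loss `l(x,y;β) = (y - βᵀx)²` and the cost `c = N_q²`, where
`N_q((x,y),(u,v)) = ‖x-u‖_q` if `y = v` and `+∞` otherwise, `q ∈ (1,∞]`, `1/p + 1/q = 1`:
for every `δ > 0`,
`min_β sup { E_P[l(X,Y;β)] : D_c(P,P_n) ≤ δ } = min_β ( √(MSE_n(β)) + √δ ‖β‖_p )²`. -/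
theorem dr_generalized_lasso_representation
    (d n : ℕ) (hn : 0 < n)
    (q p : ℝ≥0∞) (hq : 1 < q) (hpq : p⁻¹ + q⁻¹ = 1)
    (X : Fin n → (Fin d → ℝ)) (Y : Fin n → ℝ)
    (c : ((Fin d → ℝ) × ℝ) → ((Fin d → ℝ) × ℝ) → ℝ≥0∞)
    (hc : ∀ x y u v, c (x, y) (u, v) =
      if y = v then ENNReal.ofReal (lpNorm q (x - u) ^ 2) else ⊤)
    (δ : ℝ) (hδ : 0 < δ) :
    (⨅ β : Fin d → ℝ,
        ⨆ (P : Measure ((Fin d → ℝ) × ℝ)) (_ : IsProbabilityMeasure P)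
          (_ : OTCost c P (empMeas (fun i => (X i, Y i))) ≤ ENNReal.ofReal δ),
          eExp P (fun z => (z.2 - ∑ j, β j * z.1 j) ^ 2))
      = ((⨅ β : Fin d → ℝ,
            (Real.sqrt ((n : ℝ)⁻¹ * ∑ i, (Y i - ∑ j, β j * X i j) ^ 2)
              + Real.sqrt δ * lpNorm p β) ^ 2 : ℝ) : EReal) := by
  rw [EReal.coe_iInf_of_nonneg fun b => sq_nonneg _]
  refine iInf_congr fun b => le_antisymm ?_ ?_
  · refine iSup_le fun P => iSup₂_le fun _ hP => ?_
    rw [eExp_of_nonneg P fun z => sq_nonneg _]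
    have h := EReal.coe_ennreal_le_coe_ennreal_iff.2
      (lintegral_residual_sq_le_of_OTCost_le X Y hn hq hpq hc hδ.le b hP)
    rwa [EReal.coe_ennreal_ofReal, max_eq_left (sq_nonneg _)] at h
  · obtain ⟨P, hP_prob, hP, hP_eq⟩ :=
      exists_OTCost_le_lintegral_residual_sq_eq X Y hn hq hpq hc hδ.le b
    refine le_iSup_of_le P (le_iSup₂_of_le hP_prob hP ?_)
    rw [eExp_of_nonneg P fun z => sq_nonneg _, hP_eq, EReal.coe_ennreal_ofReal,
      max_eq_left (sq_nonneg _)]
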